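/- Packing entropy via countable covers and upper capacity entropy: Let ε > 0, Z ⊆ X, and {F_n} a sequence of finite subsets of G satisfying the growth condition. (1) h^P_top(Z,ε,{F_n}) ≤ inf{ sup_{i≥1} h^{UC}_top(Z_i,ε,{F_n}) : Z = ⋃_{i=1}^∞ Z_i }, and hence h^P_top(Z,{F_n}) ≤ inf{ sup_{i≥1} h^{UC}_top(Z_i,{F_n}) : Z = ⋃_{i=1}^∞ Z_i }. (2) For any δ > 0 there exists a countable cover Z = ⋃_{i=1}^∞ Z_i (depending on ε and δ) such that h^P_top(Z,ε,{F_n}) + δ ≥ sup_{i≥1} h^{UC}_top(Z_i,3ε,{F_n}). -/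

import Mathlib

open Filter Set MeasureTheory ENNReal Topology
open scoped Pointwise symmDiff NNReal

namespace AmenablePacking

variable {G X Y : Type*}

/-- The open dynamical (Bowen) ball of center `x` and radius `ε` over the finite set `F`. -/
def dynBall [PseudoMetricSpace X] (act : G → X → X) (F : Finset G) (x : X) (ε : ℝ) : Set X :=
  {y | ∀ g ∈ F, dist (act g x) (act g y) < ε}

/-- The closed dynamical (Bowen) ball of center `x` and radius `ε` over the finite set `F`. -/
def dynClosedBall [PseudoMetricSpace X] (act : G → X → X) (F : Finset G) (x : X) (ε : ℝ) :
    Set X :=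
  {y | ∀ g ∈ F, dist (act g x) (act g y) ≤ ε}

/-- The packing pre-measure `P(Z, N, ε, s, {F_n})`: the supremum of `∑ᵢ exp (- s |F_{n_i}|)` over
all finite or countable pairwise disjoint families of closed Bowen balls with centers in `Z`
and indices `n_i ≥ N`. -/
noncomputable def packP [PseudoMetricSpace X] (act : G → X → X) (Fs : ℕ → Finset G) (Z : Set X)
    (N : ℕ) (ε s : ℝ) : ℝ≥0∞ :=
  ⨆ (t : Set ℕ) (c : ℕ → X × ℕ) (_ : ∀ i ∈ t, (c i).1 ∈ Z ∧ N ≤ (c i).2)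
    (_ : ∀ i ∈ t, ∀ j ∈ t, i ≠ j →
      Disjoint (dynClosedBall act (Fs (c i).2) (c i).1 ε)
        (dynClosedBall act (Fs (c j).2) (c j).1 ε)),
    ∑' i : t, ENNReal.ofReal (Real.exp (-s * ((Fs (c (i : ℕ)).2).card : ℝ)))

/-- `P(Z, ε, s, {F_n}) = lim_{N → ∞} P(Z, N, ε, s, {F_n})`; the quantity is non-increasing
in `N`, so the limit equals the infimum. -/
noncomputable def packPLim [PseudoMetricSpace X] (act : G → X → X) (Fs : ℕ → Finset G)
    (Z : Set X) (ε s : ℝ) : ℝ≥0∞ :=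
  ⨅ N : ℕ, packP act Fs Z N ε s

/-- `𝒫(Z, ε, s, {F_n})`: the countably subadditive envelope of `P(·, ε, s, {F_n})`. -/
noncomputable def packOuter [PseudoMetricSpace X] (act : G → X → X) (Fs : ℕ → Finset G)
    (Z : Set X) (ε s : ℝ) : ℝ≥0∞ :=
  ⨅ (Zs : ℕ → Set X) (_ : Z ⊆ ⋃ i, Zs i), ∑' i, packPLim act Fs (Zs i) ε s

/-- `h^P_top(Z, ε, {F_n})`: the critical value of `s ≥ 0` at which `𝒫(Z, ε, s, {F_n})` jumps
from `+∞` to `0`. -/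
noncomputable def packEntEps [PseudoMetricSpace X] (act : G → X → X) (Fs : ℕ → Finset G)
    (Z : Set X) (ε : ℝ) : ℝ≥0∞ :=
  ⨅ (s : ℝ≥0) (_ : packOuter act Fs Z ε (s : ℝ) = 0), (s : ℝ≥0∞)

/-- The amenable packing topological entropy
`h^P_top(Z, {F_n}) = lim_{ε → 0} h^P_top(Z, ε, {F_n})`. -/
noncomputable def packEnt [PseudoMetricSpace X] (act : G → X → X) (Fs : ℕ → Finset G)
    (Z : Set X) : ℝ≥0∞ :=
  ⨆ (ε : ℝ) (_ : 0 < ε), packEntEps act Fs Z ε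

/-- The Bowen pre-measure `ℳ(Z, N, ε, s, {F_n})`: the infimum of `∑ᵢ exp (- s |F_{n_i}|)` over
all finite or countable families of open Bowen balls with indices `n_i ≥ N` covering `Z`. -/
noncomputable def bowenM [PseudoMetricSpace X] (act : G → X → X) (Fs : ℕ → Finset G) (Z : Set X)
    (N : ℕ) (ε s : ℝ) : ℝ≥0∞ :=
  ⨅ (t : Set ℕ) (c : ℕ → X × ℕ) (_ : ∀ i ∈ t, N ≤ (c i).2)
    (_ : Z ⊆ ⋃ i ∈ t, dynBall act (Fs (c i).2) (c i).1 ε),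
    ∑' i : t, ENNReal.ofReal (Real.exp (-s * ((Fs (c (i : ℕ)).2).card : ℝ)))

/-- `ℳ(Z, s, {F_n}) = lim_{ε → 0} lim_{N → ∞} ℳ(Z, N, ε, s, {F_n})`. -/
noncomputable def bowenMLim [PseudoMetricSpace X] (act : G → X → X) (Fs : ℕ → Finset G)
    (Z : Set X) (s : ℝ) : ℝ≥0∞ :=
  ⨆ (ε : ℝ) (_ : 0 < ε), ⨆ N : ℕ, bowenM act Fs Z N ε s

/-- The amenable Bowen topological entropy `h^B_top(Z, {F_n})`: the critical value of `s ≥ 0`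
at which `ℳ(Z, s, {F_n})` jumps from `+∞` to `0`. -/
noncomputable def bowenEnt [PseudoMetricSpace X] (act : G → X → X) (Fs : ℕ → Finset G)
    (Z : Set X) : ℝ≥0∞ :=
  ⨅ (s : ℝ≥0) (_ : bowenMLim act Fs Z (s : ℝ) = 0), (s : ℝ≥0∞)

/-- `E` is an `(F, ε)`-separated set: distinct points are at `d_F`-distance `> ε`. -/
def IsDynSeparated [PseudoMetricSpace X] (act : G → X → X) (F : Finset G) (ε : ℝ)
    (E : Set X) : Prop :=
  ∀ x ∈ E, ∀ y ∈ E, x ≠ y → ∃ g ∈ F, ε < dist (act g x) (act g y)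

/-- `s_F(Z, ε)`: the maximal cardinality of an `(F, ε)`-separated subset of `Z`. -/
noncomputable def sepNum [PseudoMetricSpace X] (act : G → X → X) (F : Finset G) (Z : Set X)
    (ε : ℝ) : ℕ :=
  sSup {k : ℕ | ∃ E : Finset X, ↑E ⊆ Z ∧ IsDynSeparated act F ε ↑E ∧ E.card = k}

/-- The upper capacity entropy of `Z` at scale `ε`:
`limsup_n (1/|F_n|) log s_{F_n}(Z, ε)`. -/
noncomputable def ucEntEps [PseudoMetricSpace X] (act : G → X → X) (Fs : ℕ → Finset G)
    (Z : Set X) (ε : ℝ) : ℝ≥0∞ :=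
  limsup (fun n => ENNReal.ofReal (Real.log ((sepNum act (Fs n) Z ε : ℝ)) / ((Fs n).card : ℝ)))
    atTop

/-- The upper capacity topological entropy `h^{UC}_top(Z, {F_n})`. -/
noncomputable def ucEnt [PseudoMetricSpace X] (act : G → X → X) (Fs : ℕ → Finset G)
    (Z : Set X) : ℝ≥0∞ :=
  ⨆ (ε : ℝ) (_ : 0 < ε), ucEntEps act Fs Z ε

/-- The upper local entropy `h̄^loc_μ(Z, {F_n}) =
`∫_Z lim_{ε→0} limsup_n -(1/|F_n|) log μ(B_{F_n}(x, ε)) dμ`. -/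
noncomputable def upperLocalEnt [PseudoMetricSpace X] [MeasurableSpace X] (act : G → X → X)
    (Fs : ℕ → Finset G) (μ : Measure X) (Z : Set X) : ℝ≥0∞ :=
  ∫⁻ x in Z, ⨆ (ε : ℝ) (_ : 0 < ε),
    limsup (fun n =>
      ENNReal.ofReal (-Real.log ((μ (dynBall act (Fs n) x ε)).toReal) / ((Fs n).card : ℝ)))
      atTop ∂μ

/-- A Følner sequence: a sequence of nonempty finite subsets of `G` which is asymptotically
invariant, i.e. `|g F_n ∆ F_n| / |F_n| → 0` for every `g ∈ G`. -/
def Folner [Group G] [DecidableEq G] (Fs : ℕ → Finset G) : Prop :=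
  (∀ n, (Fs n).Nonempty) ∧
    ∀ g : G,
      Tendsto (fun n => ((((Fs n).image fun h => g * h) ∆ Fs n).card : ℝ) / ((Fs n).card : ℝ))
        atTop (nhds 0)

/-- A tempered sequence: `|⋃_{k < n} F_k⁻¹ F_n| ≤ C |F_n|` for a constant `C > 0`. -/
def Tempered [Group G] [DecidableEq G] (Fs : ℕ → Finset G) : Prop :=
  ∃ C : ℝ, 0 < C ∧
    ∀ n : ℕ, ((((Finset.range n).biUnion fun k => (Fs k)⁻¹ * Fs n).card : ℝ))
      ≤ C * ((Fs n).card : ℝ)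

/-- The growth condition `lim_n |F_n| / log n = +∞`. -/
def GrowthCond (Fs : ℕ → Finset G) [Group G] : Prop :=
  Tendsto (fun n => ((Fs n).card : ℝ) / Real.log (n : ℝ)) atTop atTop

/-- The static (Shannon) entropy of the finite measurable partition of `X` induced by a map
into a finite set. -/
noncomputable def partEnt [MeasurableSpace X] (μ : Measure X) {ι : Type*} [Fintype ι]
    (P : X → ι) : ℝ :=
  ∑ i : ι, Real.negMulLog ((μ (P ⁻¹' {i})).toReal)

/-- The measure-theoretic (Kolmogorov–Sinai) entropy `h_μ(X, G)` of the action w.r.t. the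
invariant measure `μ`, computed along the Følner sequence `{F_n}`: the supremum over finite
measurable partitions `P` of `lim_n (1/|F_n|) H_μ(⋁_{g ∈ F_n} (act g)⁻¹ P)`. -/
noncomputable def measEnt [MeasurableSpace X] [DecidableEq G] (act : G → X → X)
    (Fs : ℕ → Finset G) (μ : Measure X) : ℝ≥0∞ :=
  ⨆ (k : ℕ) (P : X → Fin k) (_ : Measurable P),
    limsup (fun n => ENNReal.ofReal
      ((partEnt μ fun x (g : (Fs n : Finset G)) => P (act (g : G) x)) / ((Fs n).card : ℝ)))
      atTop

/-- The set of generic points of `μ` w.r.t. `{F_n}`. -/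
def genericPoints [TopologicalSpace X] [MeasurableSpace X] (act : G → X → X)
    (Fs : ℕ → Finset G) (μ : Measure X) : Set X :=
  {x | ∀ f : C(X, ℝ),
    Tendsto (fun n => (∑ g ∈ Fs n, f (act g x)) / ((Fs n).card : ℝ)) atTop
      (nhds (∫ y, f y ∂μ))}

/-- `μ` is invariant under the action. -/
def InvariantMeasure [MeasurableSpace X] (act : G → X → X) (μ : Measure X) : Prop :=
  ∀ (g : G) (s : Set X), MeasurableSet s → μ (act g ⁻¹' s) = μ s

/-- The action is ergodic w.r.t. `μ`: every invariant measurable set is null or conull. -/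
def ErgodicAction [MeasurableSpace X] (act : G → X → X) (μ : Measure X) : Prop :=
  ∀ s : Set X, MeasurableSet s → (∀ g : G, act g ⁻¹' s = s) → μ s = 0 ∨ μ s = 1

section SeparatedSets

variable [PseudoMetricSpace X] {act : G → X → X} {ε : ℝ}

theorem exists_card_le_of_isDynSeparated [CompactSpace X] (hact : ∀ g, Continuous (act g))
    (F : Finset G) (hε : 0 < ε) :
    ∃ M : ℕ, ∀ E : Finset X, IsDynSeparated act F ε ↑E → E.card ≤ M := by
  have hnhds : ∀ x ∈ (univ : Set X), dynBall act F x (ε / 2) ∈ 𝓝 x := by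
    intro x _
    have h : ∀ᶠ y in 𝓝 x, ∀ g ∈ F, dist (act g x) (act g y) < ε / 2 := by
      rw [Filter.eventually_all_finset]
      intro g _
      have hc : Continuous fun y => dist (act g x) (act g y) :=
        continuous_const.dist (hact g)
      refine hc.continuousAt.eventually_lt_const ?_
      simpa using half_pos hε
    exact h
  obtain ⟨t, -, ht⟩ := isCompact_univ.elim_nhds_subcover _ hnhds
  have hmem : ∀ x : X, ∃ y ∈ t, x ∈ dynBall act F y (ε / 2) := fun x => by
    simpa using ht (mem_univ x)
  choose p hpt hp using hmem
  refine ⟨t.card, fun E hE => Finset.card_le_card_of_injOn p (fun x _ => hpt x) ?_⟩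
  intro x hx y hy hxy
  by_contra hne
  obtain ⟨g, hg, hlt⟩ := hE x hx y hy hne
  have h₁ := hp x g hg
  have h₂ := hp y g hg
  rw [← hxy] at h₂
  linarith [dist_triangle_left (act g x) (act g y) (act g (p x))]

theorem bddAbove_card_isDynSeparated [CompactSpace X] (hact : ∀ g, Continuous (act g))
    (F : Finset G) (Z : Set X) (hε : 0 < ε) :
    BddAbove {k : ℕ | ∃ E : Finset X, ↑E ⊆ Z ∧ IsDynSeparated act F ε ↑E ∧ E.card = k} := by
  obtain ⟨M, hM⟩ := exists_card_le_of_isDynSeparated hact F hε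
  refine ⟨M, ?_⟩
  rintro _ ⟨E, -, hE, rfl⟩
  exact hM E hE

theorem card_le_sepNum [CompactSpace X] (hact : ∀ g, Continuous (act g)) (F : Finset G)
    {Z : Set X} (hε : 0 < ε) {E : Finset X} (hEZ : ↑E ⊆ Z) (hE : IsDynSeparated act F ε ↑E) :
    E.card ≤ sepNum act F Z ε :=
  le_csSup (bddAbove_card_isDynSeparated hact F Z hε) ⟨E, hEZ, hE, rfl⟩

theorem exists_card_eq_sepNum [CompactSpace X] (hact : ∀ g, Continuous (act g)) (F : Finset G)
    (Z : Set X) (hε : 0 < ε) :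
    ∃ E : Finset X, ↑E ⊆ Z ∧ IsDynSeparated act F ε ↑E ∧ E.card = sepNum act F Z ε := by
  have hbdd := bddAbove_card_isDynSeparated hact F Z hε
  refine Nat.sSup_mem ⟨0, ?_⟩ hbdd
  exact ⟨∅, by simp, by simp [IsDynSeparated], rfl⟩

theorem mem_dynClosedBall_self (F : Finset G) (x : X) (hε : 0 ≤ ε) :
    x ∈ dynClosedBall act F x ε := fun g _ => by simpa using hε

theorem exists_lt_dist_of_disjoint_dynClosedBall {F : Finset G} {x y : X} (hε : 0 ≤ ε)
    (h : Disjoint (dynClosedBall act F x ε) (dynClosedBall act F y ε)) :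
    ∃ g ∈ F, ε < dist (act g x) (act g y) := by
  have hy : y ∉ dynClosedBall act F x ε := fun hy =>
    Set.disjoint_left.1 h hy (mem_dynClosedBall_self F y hε)
  simpa [dynClosedBall] using hy

theorem disjoint_dynClosedBall_of_lt_dist {F : Finset G} {x y : X} (hε : 0 < ε)
    (h : ∃ g ∈ F, 3 * ε < dist (act g x) (act g y)) :
    Disjoint (dynClosedBall act F x ε) (dynClosedBall act F y ε) := by
  obtain ⟨g, hg, hlt⟩ := h
  refine Set.disjoint_left.2 fun z hx hy => ?_
  have h₁ := hx g hg
  have h₂ := hy g hg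
  linarith [dist_triangle_right (act g x) (act g y) (act g z)]

theorem eventually_sepNum_le_exp {Fs : ℕ → Finset G} (hne : ∀ n, (Fs n).Nonempty) {Z : Set X}
    {u : ℝ}
    (hu : ucEntEps act Fs Z ε < ENNReal.ofReal u) :
    ∀ᶠ n in atTop, (sepNum act (Fs n) Z ε : ℝ) ≤ Real.exp (u * (Fs n).card) := by
  filter_upwards [eventually_lt_of_limsup_lt hu] with n hn
  have hcard : (0 : ℝ) < (Fs n).card := by exact_mod_cast (hne n).card_pos
  have hlt := (ENNReal.ofReal_lt_ofReal_iff_of_nonneg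
    (div_nonneg (Real.log_natCast_nonneg _) hcard.le)).1 hn
  rcases (Nat.cast_nonneg (α := ℝ) (sepNum act (Fs n) Z ε)).eq_or_lt with h | h
  · rw [← h]
    positivity
  · rw [← Real.log_le_iff_le_exp h]
    exact ((div_lt_iff₀ hcard).1 hlt).le

end SeparatedSets

section PackingCapacity

variable [PseudoMetricSpace X] [CompactSpace X] {act : G → X → X} {Fs : ℕ → Finset G} {ε : ℝ}

theorem packP_le_tsum_sepNum (hact : ∀ g, Continuous (act g)) (hε : 0 < ε) (Z : Set X) (N : ℕ)
    (s : ℝ) :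
    packP act Fs Z N ε s ≤ ∑' k, ENNReal.ofReal
      (sepNum act (Fs (k + N)) Z ε * Real.exp (-s * ((Fs (k + N)).card : ℝ))) := by
  refine iSup₂_le fun t c => iSup₂_le fun hc hd => ?_
  rw [← ENNReal.tsum_fiberwise _ fun i : t => (c i).2 - N]
  refine ENNReal.tsum_le_tsum fun k => ?_
  rw [ENNReal.tsum_eq_iSup_sum]
  refine iSup_le fun S => ?_
  have hidx : ∀ b : (fun i : t => (c i).2 - N) ⁻¹' {k}, (c (b : t)).2 = k + N := by
    rintro ⟨b, hb⟩
    have h₁ := (hc b b.2).2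
    have h₂ : (c b).2 - N = k := hb
    change (c b).2 = k + N
    omega
  have hsep : ∀ b b' : (fun i : t => (c i).2 - N) ⁻¹' {k}, b ≠ b' →
      ∃ g ∈ Fs (k + N), ε < dist (act g (c (b : t)).1) (act g (c (b' : t)).1) := by
    intro b b' hne
    have h := hd (b : t) b.1.2 (b' : t) b'.1.2 fun h => hne (Subtype.ext (Subtype.ext h))
    rw [hidx b, hidx b'] at h
    exact exists_lt_dist_of_disjoint_dynClosedBall hε.le h
  have hcard : S.card ≤ sepNum act (Fs (k + N)) Z ε := by
    classical
    have hinj : Function.Injective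
        fun b : (fun i : t => (c i).2 - N) ⁻¹' {k} => (c (b : t)).1 := by
      intro b b' h
      by_contra hne
      obtain ⟨g, -, hlt⟩ := hsep b b' hne
      have h' : (c (b : t)).1 = (c (b' : t)).1 := h
      rw [h', dist_self] at hlt
      exact hε.not_gt hlt
    rw [← Finset.card_image_of_injective S hinj]
    refine card_le_sepNum hact _ hε ?_ ?_
    · intro x hx
      simp only [Finset.coe_image, Set.mem_image] at hx
      obtain ⟨b, -, rfl⟩ := hx
      exact (hc (b : t) b.1.2).1
    · intro x hx y hy hne
      simp only [Finset.coe_image, Set.mem_image] at hx hy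
      obtain ⟨b, -, rfl⟩ := hx
      obtain ⟨b', -, rfl⟩ := hy
      exact hsep b b' fun h => hne (by rw [h])
  have hsum : ∑ b ∈ S, ENNReal.ofReal (Real.exp (-s * ((Fs (c (b : t)).2).card : ℝ))) =
      S.card * ENNReal.ofReal (Real.exp (-s * ((Fs (k + N)).card : ℝ))) := by
    rw [← nsmul_eq_mul]
    refine Finset.sum_eq_card_nsmul fun b _ => ?_
    rw [hidx b]
  rw [hsum, ENNReal.ofReal_mul (Nat.cast_nonneg _), ENNReal.ofReal_natCast]
  gcongr

theorem GrowthCond.summable_exp_neg [Group G] (hgrow : GrowthCond Fs) {r : ℝ} (hr : 0 < r) :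
    Summable fun n => Real.exp (-r * ((Fs n).card : ℝ)) := by
  refine Summable.of_norm_bounded_eventually_nat
    (Real.summable_one_div_nat_pow.2 (one_lt_two : 1 < 2)) ?_
  filter_upwards [hgrow.eventually_ge_atTop (2 / r), eventually_gt_atTop 1] with n hn h1
  have hn0 : (0 : ℝ) < n := by exact_mod_cast zero_lt_one.trans h1
  have hlog : 0 < Real.log n := Real.log_pos (by exact_mod_cast h1)
  rw [Real.norm_of_nonneg (Real.exp_nonneg _)]
  have h2 : 2 * Real.log n ≤ r * (Fs n).card := by
    have := (le_div_iff₀ hlog).1 hn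
    rw [div_mul_eq_mul_div, div_le_iff₀ hr] at this
    linarith
  calc Real.exp (-r * ((Fs n).card : ℝ)) ≤ Real.exp (-(2 * Real.log n)) :=
        Real.exp_le_exp.2 (by linarith)
    _ = 1 / (n : ℝ) ^ 2 := by
        rw [Real.exp_neg, two_mul, Real.exp_add, Real.exp_log hn0, one_div, sq]

theorem packPLim_eq_zero_of_ucEntEps_lt [Group G] (hact : ∀ g, Continuous (act g))
    (hne : ∀ n, (Fs n).Nonempty) (hgrow : GrowthCond Fs) (hε : 0 < ε) {Z : Set X} {s : ℝ}
    (hs : ucEntEps act Fs Z ε < ENNReal.ofReal s) : packPLim act Fs Z ε s = 0 := by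
  obtain ⟨u, hu0, hu, hus⟩ := ENNReal.lt_iff_exists_real_btwn.1 hs
  have hus' : u < s := (ENNReal.ofReal_lt_ofReal_iff_of_nonneg hu0).1 hus
  have hsum : Summable fun n =>
      (sepNum act (Fs n) Z ε : ℝ) * Real.exp (-s * ((Fs n).card : ℝ)) := by
    refine Summable.of_norm_bounded_eventually_nat
      (hgrow.summable_exp_neg (sub_pos.2 hus')) ?_
    filter_upwards [eventually_sepNum_le_exp hne hu] with n hn
    rw [Real.norm_of_nonneg (by positivity)]
    calc (sepNum act (Fs n) Z ε : ℝ) * Real.exp (-s * ((Fs n).card : ℝ))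
        ≤ Real.exp (u * (Fs n).card) * Real.exp (-s * ((Fs n).card : ℝ)) := by gcongr
      _ = Real.exp (-(s - u) * ((Fs n).card : ℝ)) := by
        rw [← Real.exp_add]
        ring_nf
  have htail := ENNReal.tendsto_sum_nat_add _ hsum.tsum_ofReal_ne_top
  refine le_antisymm (ge_of_tendsto' htail fun N => ?_) zero_le
  exact (iInf_le _ N).trans (packP_le_tsum_sepNum hact hε Z N s)

theorem packEntEps_le_iSup_ucEntEps [Group G] (hact : ∀ g, Continuous (act g))
    (hne : ∀ n, (Fs n).Nonempty) (hgrow : GrowthCond Fs) (hε : 0 < ε) {Z : Set X}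
    {Zs : ℕ → Set X} (hZ : Z ⊆ ⋃ i, Zs i) :
    packEntEps act Fs Z ε ≤ ⨆ i, ucEntEps act Fs (Zs i) ε := by
  refine ENNReal.le_of_forall_pos_le_add fun η hη hfin => ?_
  lift (⨆ i, ucEntEps act Fs (Zs i) ε) to ℝ≥0 using hfin.ne with h hh
  rw [← ENNReal.coe_add]
  refine iInf₂_le (f := fun (r : ℝ≥0) (_ : packOuter act Fs Z ε r = 0) => (r : ℝ≥0∞))
    (h + η) (le_antisymm ?_ zero_le)
  refine (iInf₂_le Zs hZ).trans_eq (ENNReal.tsum_eq_zero.2 fun i => ?_)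
  refine packPLim_eq_zero_of_ucEntEps_lt hact hne hgrow hε ?_
  rw [ENNReal.ofReal_coe_nnreal]
  calc ucEntEps act Fs (Zs i) ε ≤ h := hh ▸ le_iSup (fun i => ucEntEps act Fs (Zs i) ε) i
    _ < ((h + η : ℝ≥0) : ℝ≥0∞) := by exact_mod_cast lt_add_of_pos_right h hη

theorem sepNum_mul_exp_le_packP (hact : ∀ g, Continuous (act g)) (hε : 0 < ε) (Z : Set X)
    {N n : ℕ} (hn : N ≤ n) (s : ℝ) :
    ENNReal.ofReal (sepNum act (Fs n) Z (3 * ε) * Real.exp (-s * ((Fs n).card : ℝ))) ≤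
      packP act Fs Z N ε s := by
  obtain ⟨E, hEZ, hE, hcard⟩ := exists_card_eq_sepNum hact (Fs n) Z (show 0 < 3 * ε by linarith)
  rw [← hcard]
  rcases E.eq_empty_or_nonempty with rfl | ⟨x₀, -⟩
  · simp
  let e := E.equivFin
  let c : ℕ → X × ℕ := fun i => (if h : i < E.card then (e.symm ⟨i, h⟩ : X) else x₀, n)
  have hc : ∀ i (h : i < E.card), (c i).1 = e.symm ⟨i, h⟩ := fun i h => dif_pos h
  refine le_trans (le_of_eq ?_) (le_iSup₂_of_le (Set.Iio E.card) c (le_iSup₂_of_le ?_ ?_ le_rfl))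
  · rw [ENNReal.ofReal_mul (Nat.cast_nonneg _), ENNReal.ofReal_natCast]
    simp only [c]
    rw [ENNReal.tsum_const]
    simp
  · intro i hi
    refine ⟨?_, hn⟩
    rw [hc i hi]
    exact hEZ (e.symm ⟨i, hi⟩).2
  · intro i hi j hj hij
    refine disjoint_dynClosedBall_of_lt_dist hε ?_
    rw [hc i hi, hc j hj]
    refine hE _ (e.symm ⟨i, hi⟩).2 _ (e.symm ⟨j, hj⟩).2 fun h => hij ?_
    exact congrArg Fin.val (e.symm.injective (Subtype.ext h))

theorem ucEntEps_three_mul_le_of_packPLim_lt_one (hact : ∀ g, Continuous (act g))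
    (hne : ∀ n, (Fs n).Nonempty) (hε : 0 < ε) {Z Z' : Set X} (hZ : Z' ⊆ Z) {s : ℝ≥0}
    (hs : packPLim act Fs Z ε s < 1) : ucEntEps act Fs Z' (3 * ε) ≤ s := by
  obtain ⟨N, hN⟩ := iInf_lt_iff.1 hs
  refine limsup_le_of_le (h := ?_)
  filter_upwards [eventually_ge_atTop N] with n hn
  have hcard : (0 : ℝ) < (Fs n).card := by exact_mod_cast (hne n).card_pos
  rw [← ENNReal.ofReal_coe_nnreal]
  refine ENNReal.ofReal_le_ofReal ?_
  rw [div_le_iff₀ hcard]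
  obtain ⟨E, hEZ, hE, hEcard⟩ :=
    exists_card_eq_sepNum hact (Fs n) Z' (show 0 < 3 * ε by linarith)
  have hmono : sepNum act (Fs n) Z' (3 * ε) ≤ sepNum act (Fs n) Z (3 * ε) :=
    hEcard ▸ card_le_sepNum hact (Fs n) (by linarith) (hEZ.trans hZ) hE
  have hlt := (sepNum_mul_exp_le_packP hact hε Z hn s).trans_lt hN
  rw [ENNReal.ofReal_lt_one, neg_mul, Real.exp_neg, ← div_eq_mul_inv,
    div_lt_one (Real.exp_pos _)] at hlt
  rcases (sepNum act (Fs n) Z' (3 * ε)).eq_zero_or_pos with h | h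
  · rw [h]
    simp only [Nat.cast_zero, Real.log_zero]
    positivity
  · rw [Real.log_le_iff_le_exp (by exact_mod_cast h)]
    exact (Nat.cast_le.2 hmono).trans hlt.le

theorem exists_cover_ucEntEps_three_mul_le (hact : ∀ g, Continuous (act g))
    (hne : ∀ n, (Fs n).Nonempty) (hε : 0 < ε) (Z : Set X) {δ : ℝ} (hδ : 0 < δ) :
    ∃ Zs : ℕ → Set X, Z = ⋃ i, Zs i ∧
      ⨆ i, ucEntEps act Fs (Zs i) (3 * ε) ≤ packEntEps act Fs Z ε + ENNReal.ofReal δ := by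
  rcases eq_or_ne (packEntEps act Fs Z ε) ⊤ with htop | hfin
  · exact ⟨fun _ => Z, (iUnion_const Z).symm, by simp [htop]⟩
  have hlt : packEntEps act Fs Z ε < packEntEps act Fs Z ε + ENNReal.ofReal δ :=
    ENNReal.lt_add_right hfin (by simpa using hδ)
  obtain ⟨s, hs⟩ := iInf_lt_iff.1 hlt
  obtain ⟨hs0, hslt⟩ := iInf_lt_iff.1 hs
  have hs1 : packOuter act Fs Z ε s < 1 := hs0 ▸ zero_lt_one
  obtain ⟨Zs, hZs⟩ := iInf_lt_iff.1 hs1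
  obtain ⟨hcov, hsum⟩ := iInf_lt_iff.1 hZs
  refine ⟨fun i => Z ∩ Zs i, ?_, iSup_le fun i => ?_⟩
  · rw [← inter_iUnion, inter_eq_left.2 hcov]
  · exact (ucEntEps_three_mul_le_of_packPLim_lt_one hact hne hε inter_subset_right
      ((ENNReal.le_tsum i).trans_lt hsum)).trans hslt.le

end PackingCapacity

theorem packing_entropy_via_covers_upper_capacity
    [Group G] [Countable G] [Infinite G] [DecidableEq G]
    [MetricSpace X] [CompactSpace X] [MeasurableSpace X] [BorelSpace X]
    (act : G → X → X)
    (hact_one : ∀ x, act 1 x = x)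
    (hact_mul : ∀ g h x, act (g * h) x = act g (act h x))
    (hact_cont : ∀ g : G, Continuous (act g))
    (hamen : ∃ E : ℕ → Finset G, Folner E)
    (Fs : ℕ → Finset G) (hne : ∀ n, (Fs n).Nonempty) (hgrow : GrowthCond Fs)
    (Z : Set X) (ε : ℝ) (hε : 0 < ε) :
    (packEntEps act Fs Z ε ≤
      ⨅ (Zi : ℕ → Set X) (_ : Z = ⋃ i, Zi i), ⨆ i, ucEntEps act Fs (Zi i) ε) ∧
    (packEnt act Fs Z ≤
      ⨅ (Zi : ℕ → Set X) (_ : Z = ⋃ i, Zi i), ⨆ i, ucEnt act Fs (Zi i)) ∧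
    (∀ δ : ℝ, 0 < δ → ∃ Zi : ℕ → Set X, Z = ⋃ i, Zi i ∧
      ⨆ i, ucEntEps act Fs (Zi i) (3 * ε) ≤ packEntEps act Fs Z ε + ENNReal.ofReal δ) := by
  refine ⟨le_iInf₂ fun Zi hZi => packEntEps_le_iSup_ucEntEps hact_cont hne hgrow hε hZi.le,
    le_iInf₂ fun Zi hZi => iSup₂_le fun ε' hε' => ?_,
    fun δ hδ => exists_cover_ucEntEps_three_mul_le hact_cont hne hε Z hδ⟩
  refine (packEntEps_le_iSup_ucEntEps hact_cont hne hgrow hε' hZi.le).trans ?_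
  exact iSup_mono fun i =>
    le_iSup₂ (f := fun (r : ℝ) (_ : 0 < r) => ucEntEps act Fs (Zi i) r) ε' hε'

end AmenablePacking
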